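/- Let u₁, u₂ : ℝ² → ℂ be smooth solutions of the second A₂⁽¹⁾-KdV flow. Then u₂ satisfies the Boussinesq equation: ∂ₜ²u₂ = −(1/3)∂ₓ⁴u₂ + (4/3)(∂ₓu₂)² + (4/3)u₂·∂ₓ²u₂. -/

import Mathlib

/-- Partial derivative in the first (space) variable. -/
noncomputable def px (f : ℝ × ℝ → ℂ) : ℝ × ℝ → ℂ :=
  fun p => deriv (fun x => f (x, p.2)) p.1

/-- Partial derivative in the second (time) variable. -/
noncomputable def pt (f : ℝ × ℝ → ℂ) : ℝ × ℝ → ℂ :=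
  fun p => deriv (fun t => f (p.1, t)) p.2

/-- The second A₂⁽¹⁾-KdV flow. -/
def IsKdV2 (u₁ u₂ : ℝ × ℝ → ℂ) : Prop :=
  (∀ p, pt u₁ p = px (px u₁) p - (2/3 : ℂ) * px (px (px u₂)) p
      + (2/3 : ℂ) * (u₂ p * px u₂ p)) ∧
  (∀ p, pt u₂ p = -(px (px u₂) p) + 2 * px u₁ p)

/-- The system (BT)_{(u₁,u₂),k}. -/
def IsBT (u₁ u₂ : ℝ × ℝ → ℂ) (k : ℂ) (h : ℝ × ℝ → ℂ) : Prop :=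
  (∀ p, px (px h) p = -u₁ p + px u₂ p + h p * u₂ p - 3 * h p * px h p - (h p) ^ 3 - k) ∧
  (∀ p, pt h p = (2/3 : ℂ) * px u₂ p - px (px h) p - 2 * h p * px h p)

/-- The Bäcklund transformation `h ∗ (u₁, u₂)`. -/
noncomputable def btStar (h u₁ u₂ : ℝ × ℝ → ℂ) : (ℝ × ℝ → ℂ) × (ℝ × ℝ → ℂ) :=
  (fun p => u₁ p - px u₂ p + 3 * h p * px h p, fun p => u₂ p - 3 * px h p)

lemma px_eq {f : ℝ × ℝ → ℂ} (hf : ContDiff ℝ (⊤ : ℕ∞) f) (p : ℝ × ℝ) :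
    HasDerivAt (fun x => f (x, p.2)) (fderiv ℝ f p (1, 0)) p.1 := by
  have h1 : HasFDerivAt f (fderiv ℝ f p) (p.1, p.2) :=
    ((hf.differentiable (by simp)) p).hasFDerivAt
  have h2 : HasDerivAt (fun x : ℝ => (x, p.2)) ((1 : ℝ), (0 : ℝ)) p.1 :=
    (hasDerivAt_id p.1).prodMk (hasDerivAt_const p.1 p.2)
  exact h1.comp_hasDerivAt p.1 h2

lemma pt_eq {f : ℝ × ℝ → ℂ} (hf : ContDiff ℝ (⊤ : ℕ∞) f) (p : ℝ × ℝ) :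
    HasDerivAt (fun t => f (p.1, t)) (fderiv ℝ f p (0, 1)) p.2 := by
  have h1 : HasFDerivAt f (fderiv ℝ f p) (p.1, p.2) :=
    ((hf.differentiable (by simp)) p).hasFDerivAt
  have h2 : HasDerivAt (fun t : ℝ => (p.1, t)) ((0 : ℝ), (1 : ℝ)) p.2 :=
    (hasDerivAt_const p.2 p.1).prodMk (hasDerivAt_id p.2)
  exact h1.comp_hasDerivAt p.2 h2

lemma px_fun {f : ℝ × ℝ → ℂ} (hf : ContDiff ℝ (⊤ : ℕ∞) f) :
    px f = fun p => fderiv ℝ f p (1, 0) := funext fun p => (px_eq hf p).deriv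

lemma pt_fun {f : ℝ × ℝ → ℂ} (hf : ContDiff ℝ (⊤ : ℕ∞) f) :
    pt f = fun p => fderiv ℝ f p (0, 1) := funext fun p => (pt_eq hf p).deriv

lemma fderiv_smooth {f : ℝ × ℝ → ℂ} (hf : ContDiff ℝ (⊤ : ℕ∞) f) :
    ContDiff ℝ (⊤ : ℕ∞) (fderiv ℝ f) := hf.fderiv_right (by simp)

lemma px_smooth {f : ℝ × ℝ → ℂ} (hf : ContDiff ℝ (⊤ : ℕ∞) f) :
    ContDiff ℝ (⊤ : ℕ∞) (px f) := by
  rw [px_fun hf]; exact (fderiv_smooth hf).clm_apply contDiff_const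

lemma pt_smooth {f : ℝ × ℝ → ℂ} (hf : ContDiff ℝ (⊤ : ℕ∞) f) :
    ContDiff ℝ (⊤ : ℕ∞) (pt f) := by
  rw [pt_fun hf]; exact (fderiv_smooth hf).clm_apply contDiff_const

lemma pt_px_comm {f : ℝ × ℝ → ℂ} (hf : ContDiff ℝ (⊤ : ℕ∞) f) :
    pt (px f) = px (pt f) := by
  rw [pt_fun (px_smooth hf), px_fun (pt_smooth hf), px_fun hf, pt_fun hf]
  funext p
  have hd : DifferentiableAt ℝ (fderiv ℝ f) p := (fderiv_smooth hf).differentiable (by simp) p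
  have hs : IsSymmSndFDerivAt ℝ f p := by
    apply hf.contDiffAt.isSymmSndFDerivAt
    simp
    exact WithTop.coe_le_coe.2 (le_top : (2 : ℕ∞) ≤ ⊤)
  rw [fderiv_clm_apply hd (differentiableAt_const _), fderiv_clm_apply hd (differentiableAt_const _)]
  simpa using hs (0, 1) (1, 0)

lemma px_hasDeriv {f : ℝ × ℝ → ℂ} (hf : ContDiff ℝ (⊤ : ℕ∞) f) (p : ℝ × ℝ) :
    HasDerivAt (fun x => f (x, p.2)) (px f p) p.1 := by
  rw [px_fun hf]; exact px_eq hf p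

lemma pt_hasDeriv {f : ℝ × ℝ → ℂ} (hf : ContDiff ℝ (⊤ : ℕ∞) f) (p : ℝ × ℝ) :
    HasDerivAt (fun t => f (p.1, t)) (pt f p) p.2 := by
  rw [pt_fun hf]; exact pt_eq hf p

/-- Solutions of the second A₂⁽¹⁾-KdV flow give solutions of the Boussinesq
equation. -/
theorem stmt19 (u₁ u₂ : ℝ × ℝ → ℂ)
    (hu₁ : ContDiff ℝ (⊤ : ℕ∞) u₁) (hu₂ : ContDiff ℝ (⊤ : ℕ∞) u₂)
    (hKdV : IsKdV2 u₁ u₂) :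
    ∀ p, pt (pt u₂) p = -(1/3 : ℂ) * px (px (px (px u₂))) p
        + (4/3 : ℂ) * (px u₂ p) ^ 2 + (4/3 : ℂ) * (u₂ p * px (px u₂) p) := by
  obtain ⟨h1, h2⟩ := hKdV
  have e1 := funext h1
  have e2 := funext h2
  have a1 := px_smooth hu₁
  have a2 := px_smooth a1
  have b1 := px_smooth hu₂
  have b2 := px_smooth b1
  have b3 := px_smooth b2
  -- time derivative of the second equation
  have s1 : ∀ p, pt (pt u₂) p = -(px (px (pt u₂)) p) + 2 * px (pt u₁) p := by
    intro p
    rw [← pt_px_comm hu₂, ← pt_px_comm b1, ← pt_px_comm hu₁]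
    conv_lhs => rw [e2]
    exact ((pt_hasDeriv b2 p).neg.add ((pt_hasDeriv a1 p).const_mul 2)).deriv
  have s2 : px (pt u₂) = fun p => -(px (px (px u₂)) p) + 2 * px (px u₁) p := by
    funext p
    rw [e2]
    exact ((px_hasDeriv b2 p).neg.add ((px_hasDeriv a1 p).const_mul 2)).deriv
  have s3 : ∀ p, px (px (pt u₂)) p = -(px (px (px (px u₂))) p) + 2 * px (px (px u₁)) p := by
    intro p
    rw [s2]
    exact ((px_hasDeriv b3 p).neg.add ((px_hasDeriv a2 p).const_mul 2)).deriv
  have s4 : ∀ p, px (pt u₁) p = px (px (px u₁)) p - (2/3 : ℂ) * px (px (px (px u₂))) p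
      + (2/3 : ℂ) * (px u₂ p * px u₂ p + u₂ p * px (px u₂) p) := by
    intro p
    rw [e1]
    exact (((px_hasDeriv a2 p).sub ((px_hasDeriv b3 p).const_mul (2/3 : ℂ))).add
      (((px_hasDeriv hu₂ p).mul (px_hasDeriv b1 p)).const_mul (2/3 : ℂ))).deriv
  intro p
  rw [s1, s3, s4]
  ring
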